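/- Let m ∈ ℕ and define f : (0,∞) → ℝ by f(x) = C(x−1, m)·(ψ(x) − ψ(m+1)), where ψ denotes the digamma function ψ(x) = Γ'(x)/Γ(x). Then Δ^{m+1} f(x) = 1/x for all x > 0, f(j) = 0 for j = 1,…,m+1, Δ^{m+1} f(n) → 0 as n → ∞ along positive integers, and for every q ∈ ℕ, f is eventually q-convex or eventually q-concave. (That is, f is the (m+1)-fold principal indefinite sum of the reciprocal function.) -/

import Mathlib

open Finset Filter

/-- Forward difference operator: `Δ f x = f (x + 1) - f x`. -/
noncomputable def fdiff (f : ℝ → ℝ) : ℝ → ℝ := fun x => f (x + 1) - f x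

/-- Generalized binomial coefficient `C(x, j) = x (x-1) ⋯ (x-j+1) / j!`. -/
noncomputable def gbinom (x : ℝ) (j : ℕ) : ℝ :=
  (∏ i ∈ Finset.range j, (x - i)) / (Nat.factorial j)

/-- Divided difference of `f` at the points `x 0, …, x (n-1)`. -/
noncomputable def divDiff (f : ℝ → ℝ) {n : ℕ} (x : Fin n → ℝ) : ℝ :=
  ∑ i, f (x i) / ∏ j ∈ Finset.univ.erase i, (x i - x j)

/-- `f` is `p`-convex on the set `S`: every divided difference of `f`
at `p + 2` pairwise distinct points of `S` is nonnegative. -/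
def ConvexOrderOn (f : ℝ → ℝ) (p : ℕ) (S : Set ℝ) : Prop :=
  ∀ x : Fin (p + 2) → ℝ, (∀ i, x i ∈ S) → Function.Injective x → 0 ≤ divDiff f x

/-- The class `K^p`: functions that are eventually `p`-convex or eventually `p`-concave. -/
def EvK (p : ℕ) (f : ℝ → ℝ) : Prop :=
  (∃ a > (0 : ℝ), ConvexOrderOn f p (Set.Ioi a)) ∨
    (∃ a > (0 : ℝ), ConvexOrderOn (fun x => -f x) p (Set.Ioi a))

/-- The class `D^p`: functions with `Δ^p f (n) → 0` as `n → ∞` along the integers. -/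
def DD (p : ℕ) (f : ℝ → ℝ) : Prop :=
  Filter.Tendsto (fun n : ℕ => (fdiff^[p] f) n) Filter.atTop (nhds 0)

/-- The digamma function `ψ = Γ'/Γ`. -/
noncomputable def digamma (x : ℝ) : ℝ := deriv Real.Gamma x / Real.Gamma x

/-- A multiple-gamma sequence: `G 0 = id`, `G (m+1) (x+1) = G m x * G (m+1) x`,
`G m 1 = 1`, each `G m` is positive and `C^∞` on `(0,∞)`, and the `m`-th derivative
of `ln ∘ G m` is increasing on `(0,∞)`. -/
def IsMultipleGammaSeq (G : ℕ → ℝ → ℝ) : Prop :=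
  (∀ m, ∀ x > (0 : ℝ), 0 < G m x) ∧
  (∀ m, ContDiffOn ℝ (⊤ : ℕ∞) (G m) (Set.Ioi 0)) ∧
  (∀ x > (0 : ℝ), G 0 x = x) ∧
  (∀ m, ∀ x > (0 : ℝ), G (m + 1) (x + 1) = G m x * G (m + 1) x) ∧
  (∀ m, G m 1 = 1) ∧
  (∀ m, StrictMonoOn
    (iteratedDerivWithin m (fun x => Real.log (G m x)) (Set.Ioi 0)) (Set.Ioi 0))

section DividedDifferences

theorem divDiff_cons (f : ℝ → ℝ) {n : ℕ} (a : ℝ) (v : Fin n → ℝ) :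
    divDiff f (Fin.cons a v : Fin (n + 1) → ℝ) =
      f a / ∏ j, (a - v j) +
        ∑ i, f (v i) / ((v i - a) * ∏ j ∈ univ.erase i, (v i - v j)) := by
  have hprod : ∀ {k : ℕ} (i : Fin k) (w : Fin k → ℝ),
      ∏ j ∈ univ.erase i, (w i - w j) = ∏ j, if j = i then 1 else (w i - w j) := by
    intro k i w
    rw [← Finset.mul_prod_erase univ (fun j => if j = i then (1 : ℝ) else w i - w j) (mem_univ i)]
    simp only [if_true, one_mul]
    exact Finset.prod_congr rfl fun j hj => by rw [if_neg (Finset.ne_of_mem_erase hj)]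
  unfold divDiff
  rw [Fin.sum_univ_succ]
  congr 1
  · rw [hprod, Fin.prod_univ_succ]
    simp
  · refine Finset.sum_congr rfl fun i _ => ?_
    rw [hprod, hprod, Fin.prod_univ_succ]
    simp [(Fin.succ_ne_zero i).symm]

/-- Moving one node of a divided difference. -/
theorem divDiff_update_sub (f : ℝ → ℝ) {n : ℕ} {v : Fin n → ℝ} (hv : Function.Injective v)
    (i : Fin n) {a : ℝ} (ha : ∀ j, a ≠ v j) :
    divDiff f (Function.update v i a) - divDiff f v =
      (a - v i) * divDiff f (Fin.cons a v : Fin (n + 1) → ℝ) := by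
  have hi : a - v i ≠ 0 := sub_ne_zero.2 (ha i)
  have hi' : v i - a ≠ 0 := sub_ne_zero.2 (ha i).symm
  have hterm : ∀ j ∈ univ.erase i,
      f (Function.update v i a j) /
          ∏ k ∈ univ.erase j, (Function.update v i a j - Function.update v i a k) =
        f (v j) / ∏ k ∈ univ.erase j, (v j - v k) +
          (a - v i) * (f (v j) / ((v j - a) * ∏ k ∈ univ.erase j, (v j - v k))) := by
    intro j hj
    have hji : j ≠ i := Finset.ne_of_mem_erase hj
    have hmem : i ∈ univ.erase j := Finset.mem_erase.2 ⟨hji.symm, mem_univ i⟩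
    rw [← Finset.mul_prod_erase _ _ hmem, ← Finset.mul_prod_erase _ (fun k => v j - v k) hmem,
      Function.update_of_ne hji, Function.update_self]
    have hrest : ∏ k ∈ (univ.erase j).erase i, (v j - Function.update v i a k) =
        ∏ k ∈ (univ.erase j).erase i, (v j - v k) :=
      Finset.prod_congr rfl fun k hk => by
        rw [Function.update_of_ne (Finset.ne_of_mem_erase hk)]
    have hW : ∏ k ∈ (univ.erase j).erase i, (v j - v k) ≠ 0 :=
      Finset.prod_ne_zero_iff.2 fun k hk => sub_ne_zero.2 fun h =>
        Finset.ne_of_mem_erase (Finset.mem_of_mem_erase hk) (hv h).symm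
    have h1 : v j - a ≠ 0 := sub_ne_zero.2 (ha j).symm
    have h2 : v j - v i ≠ 0 := sub_ne_zero.2 fun h => hji (hv h)
    rw [hrest]
    field_simp
    ring
  have hself : ∏ k ∈ univ.erase i, (a - Function.update v i a k) =
      ∏ k ∈ univ.erase i, (a - v k) :=
    Finset.prod_congr rfl fun k hk => by
      rw [Function.update_of_ne (Finset.ne_of_mem_erase hk)]
  have hV : ∏ k ∈ univ.erase i, (v i - v k) ≠ 0 :=
    Finset.prod_ne_zero_iff.2 fun k hk => sub_ne_zero.2 fun h =>
      Finset.ne_of_mem_erase hk (hv h).symm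
  have hA : ∏ k ∈ univ.erase i, (a - v k) ≠ 0 :=
    Finset.prod_ne_zero_iff.2 fun k _ => sub_ne_zero.2 (ha k)
  rw [divDiff_cons]
  unfold divDiff
  rw [← Finset.add_sum_erase univ _ (mem_univ i), Finset.sum_congr rfl hterm,
    Finset.sum_add_distrib, ← Finset.mul_sum, Function.update_self, hself,
    ← Finset.add_sum_erase univ (fun j => f (v j) / ∏ k ∈ univ.erase j, (v j - v k)) (mem_univ i),
    ← Finset.add_sum_erase univ
      (fun j => f (v j) / ((v j - a) * ∏ k ∈ univ.erase j, (v j - v k))) (mem_univ i),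
    ← Finset.mul_prod_erase univ (fun j => a - v j) (mem_univ i)]
  field_simp
  ring

theorem divDiff_eval_eq_zero (P : Polynomial ℝ) {n : ℕ} {v : Fin n → ℝ}
    (hv : Function.Injective v) (hP : P.natDegree + 1 < n) :
    divDiff (fun x => P.eval x) v = 0 := by
  have hdeg : P.degree < (univ : Finset (Fin n)).card := by
    rw [Finset.card_univ, Fintype.card_fin]
    exact lt_of_le_of_lt P.degree_le_natDegree (by exact_mod_cast (by omega : P.natDegree < n))
  have h := Lagrange.coeff_eq_sum (s := univ) (v := v) hv.injOn hdeg
  rw [Polynomial.coeff_eq_zero_of_natDegree_lt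
    (by rw [Finset.card_univ, Fintype.card_fin]; omega)] at h
  exact h.symm

theorem divDiff_eval_div_add (P : Polynomial ℝ) {n : ℕ} {v : Fin n → ℝ}
    (hv : Function.Injective v) (hP : P.natDegree < n) {b : ℝ} (hb : ∀ j, 0 < v j + b) :
    divDiff (fun x => P.eval x / (x + b)) v =
      -((-1) ^ n * P.eval (-b) / ∏ j, (v j + b)) := by
  have hne : ∀ j, v j ≠ -b := fun j h => by have := hb j; rw [h] at this; simp at this
  have hinj : Function.Injective (Fin.cons (-b) v : Fin (n + 1) → ℝ) :=
    Fin.cons_injective_iff.2 ⟨fun ⟨j, hj⟩ => hne j hj, hv⟩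
  have h := divDiff_eval_eq_zero P hinj (by omega)
  rw [divDiff_cons] at h
  have hprod : ∏ j, (-b - v j) = (-1) ^ n * ∏ j, (v j + b) := by
    rw [Finset.prod_congr rfl fun j _ => (by ring : -b - v j = (-1) * (v j + b)),
      Finset.prod_mul_distrib]
    simp
  have hsum : divDiff (fun x => P.eval x / (x + b)) v =
      ∑ i, P.eval (v i) / ((v i - -b) * ∏ j ∈ univ.erase i, (v i - v j)) := by
    unfold divDiff
    simp only [sub_neg_eq_add, div_div]
  have hsq : ((-1 : ℝ) ^ n) * (-1) ^ n = 1 := by rw [← mul_pow]; simp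
  have hpos : ∏ j, (v j + b) ≠ 0 := Finset.prod_ne_zero_iff.2 fun j _ => (hb j).ne'
  rw [hsum, ← add_eq_zero_iff_eq_neg, add_comm, ← h, hprod]
  congr 1
  rw [div_eq_div_iff hpos (mul_ne_zero (by positivity) hpos)]
  linear_combination (P.eval (-b) * ∏ j, (v j + b)) * hsq

theorem divDiff_neg (f : ℝ → ℝ) {n : ℕ} (v : Fin n → ℝ) :
    divDiff (fun x => -f x) v = -divDiff f v := by
  simp [divDiff, neg_div]

/-- Eventual convexity properties of order `p + 1` are inherited at order `p`. -/
theorem EvK.of_succ {p : ℕ} {f : ℝ → ℝ} (h : EvK (p + 1) f) : EvK p f := by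
  have key : ∀ g : ℝ → ℝ, (∃ a > (0 : ℝ), ConvexOrderOn g (p + 1) (Set.Ioi a)) → EvK p g := by
    rintro g ⟨a, ha, hg⟩
    by_cases hneg : ConvexOrderOn (fun x => -g x) p (Set.Ioi a)
    · exact Or.inr ⟨a, ha, hneg⟩
    left
    simp only [ConvexOrderOn, divDiff_neg, not_forall, exists_prop, not_le] at hneg
    obtain ⟨y, hya, hy, hpos⟩ := hneg
    obtain ⟨M, hM⟩ := (Set.finite_range y).bddAbove
    have hyM : ∀ i, y i ≤ M := fun i => hM ⟨i, rfl⟩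
    have haM : a < M := lt_of_lt_of_le (hya 0) (hyM 0)
    refine ⟨M, ha.trans haM, fun x hx hxi => ?_⟩
    have hxy : ∀ i j, y i < x j := fun i j => (hyM i).trans_lt (hx j)
    have hmix : ∀ s : Finset (Fin (p + 2)), Function.Injective (s.piecewise x y) := by
      intro s i j hij
      by_cases hi : i ∈ s <;> by_cases hj : j ∈ s <;>
        simp only [Finset.piecewise, hi, hj, if_true, if_false] at hij
      · exact hxi hij
      · exact absurd hij (hxy j i).ne'
      · exact absurd hij (hxy i j).ne
      · exact hy hij
    have hle : ∀ s : Finset (Fin (p + 2)), 0 ≤ divDiff g (s.piecewise x y) := by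
      intro s
      induction s using Finset.induction_on with
      | empty => rw [Finset.piecewise_empty]; linarith
      | insert i s hi ih =>
        have hne : ∀ j, x i ≠ s.piecewise x y j := by
          intro j
          by_cases hj : j ∈ s
          · rw [Finset.piecewise_eq_of_mem _ _ _ hj]
            exact fun h => hi (hxi h ▸ hj)
          · rw [Finset.piecewise_eq_of_notMem _ _ _ hj]
            exact (hxy j i).ne'
        have hstep := divDiff_update_sub g (hmix s) i hne
        have hcons : 0 ≤ divDiff g (Fin.cons (x i) (s.piecewise x y) : Fin (p + 3) → ℝ) := by
          refine hg _ (fun j => ?_) (Fin.cons_injective_iff.2 ⟨fun ⟨j, hj⟩ => hne j hj.symm, hmix s⟩)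
          refine Fin.cases ?_ (fun j => ?_) j
          · exact haM.trans (hx i)
          · rw [Fin.cons_succ]
            by_cases hj : j ∈ s
            · rw [Finset.piecewise_eq_of_mem _ _ _ hj]
              exact haM.trans (hx j)
            · rw [Finset.piecewise_eq_of_notMem _ _ _ hj]
              exact hya j
        rw [Finset.piecewise_eq_of_notMem _ _ _ hi] at hstep
        rw [Finset.piecewise_insert]
        nlinarith [mul_nonneg (sub_nonneg.2 (hxy i i).le) hcons]
    simpa using hle univ
  rcases h with h | h
  · exact key f h
  · rcases key _ h with h' | h'
    · exact Or.inr h'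
    · exact Or.inl (by simpa using h')

end DividedDifferences

section Digamma

theorem digamma_eq_deriv_log {x : ℝ} (hx : 0 < x) :
    digamma x = deriv (Real.log ∘ Real.Gamma) x := by
  have hd : DifferentiableAt ℝ Real.Gamma x :=
    Real.differentiableAt_Gamma fun m => by have : (0 : ℝ) ≤ m := m.cast_nonneg; linarith
  exact (hd.hasDerivAt.log (Real.Gamma_pos_of_pos hx).ne').deriv.symm

theorem monotoneOn_digamma : MonotoneOn digamma (Set.Ioi 0) := by
  have h : MonotoneOn (deriv (Real.log ∘ Real.Gamma)) (Set.Ioi 0) := by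
    refine Real.convexOn_log_Gamma.monotoneOn_deriv fun x hx => ?_
    have hd : DifferentiableAt ℝ Real.Gamma x :=
      Real.differentiableAt_Gamma fun m => by
        have : (0 : ℝ) ≤ m := m.cast_nonneg
        have : 0 < x := hx
        linarith
    exact (hd.hasDerivAt.log (Real.Gamma_pos_of_pos hx).ne').differentiableAt
  exact h.congr fun x hx => (digamma_eq_deriv_log hx).symm

theorem digamma_add_one {x : ℝ} (hx : 0 < x) : digamma (x + 1) = digamma x + 1 / x := by
  have hd : DifferentiableAt ℝ Real.Gamma x :=
    Real.differentiableAt_Gamma fun m => by have : (0 : ℝ) ≤ m := m.cast_nonneg; linarith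
  have hG := (Real.Gamma_pos_of_pos hx).ne'
  have hderiv : deriv Real.Gamma (x + 1) = Real.Gamma x + x * deriv Real.Gamma x := by
    rw [← deriv_comp_add_const]
    have heq : (fun y => Real.Gamma (y + 1)) =ᶠ[nhds x] fun y => y * Real.Gamma y := by
      filter_upwards [lt_mem_nhds hx] with y hy using Real.Gamma_add_one hy.ne'
    rw [heq.deriv_eq]
    have h := ((hasDerivAt_id x).mul hd.hasDerivAt).deriv
    rwa [one_mul] at h
  unfold digamma
  rw [hderiv, Real.Gamma_add_one hx.ne']
  field_simp
  ring

theorem digamma_add_nat {x : ℝ} (hx : 0 < x) (N : ℕ) :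
    digamma (x + N) = digamma x + ∑ k ∈ range N, 1 / (x + k) := by
  induction N with
  | zero => simp
  | succ N ih =>
    rw [Finset.sum_range_succ, ← add_assoc, ← ih, Nat.cast_succ, ← add_assoc,
      digamma_add_one (by positivity)]

theorem tendsto_digamma_sub_sum {x : ℝ} (hx : 0 < x) :
    Tendsto (fun N : ℕ => digamma N - ∑ k ∈ range N, 1 / (x + k)) atTop (nhds (digamma x)) := by
  obtain ⟨M, hM⟩ := exists_nat_ge x
  have hzero : Tendsto (fun N : ℕ => digamma (x + N) - digamma N) atTop (nhds 0) := by
    have hup : Tendsto (fun N : ℕ => ∑ k ∈ range M, 1 / ((N : ℝ) + k)) atTop (nhds 0) := by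
      rw [← Finset.sum_const_zero (s := range M)]
      refine tendsto_finsetSum _ fun k _ => ?_
      simp only [one_div]
      exact tendsto_inv_atTop_zero.comp
        (tendsto_atTop_add_const_right _ _ tendsto_natCast_atTop_atTop)
    refine tendsto_of_tendsto_of_tendsto_of_le_of_le' tendsto_const_nhds hup ?_ ?_ <;>
      filter_upwards [eventually_gt_atTop 0] with N hN
    all_goals have hN' : (0 : ℝ) < N := Nat.cast_pos.2 hN
    · exact sub_nonneg.2 (monotoneOn_digamma hN' (add_pos hx hN') (by linarith))
    · have h := monotoneOn_digamma (a := x + N) (b := N + M) (add_pos hx hN')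
        (add_pos_of_pos_of_nonneg hN' M.cast_nonneg) (by linarith)
      rw [digamma_add_nat hN'] at h
      linarith
  have h := (tendsto_const_nhds (x := digamma x)).sub hzero
  rw [sub_zero] at h
  refine h.congr fun N => ?_
  rw [digamma_add_nat hx]
  ring

end Digamma

section Gbinom

/-- The polynomial `C(X - 1, m)`. -/
noncomputable def gbinomPoly (m : ℕ) : Polynomial ℝ :=
  Polynomial.C ((m.factorial : ℝ)⁻¹) * ∏ i ∈ range m, (Polynomial.X - Polynomial.C (1 + i : ℝ))

theorem eval_gbinomPoly (m : ℕ) (x : ℝ) : (gbinomPoly m).eval x = gbinom (x - 1) m := by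
  simp only [gbinomPoly, gbinom, Polynomial.eval_mul, Polynomial.eval_C, Polynomial.eval_prod,
    Polynomial.eval_sub, Polynomial.eval_X, sub_sub]
  rw [div_eq_inv_mul]

theorem natDegree_gbinomPoly_le (m : ℕ) : (gbinomPoly m).natDegree ≤ m := by
  refine (Polynomial.natDegree_C_mul_le _ _).trans ?_
  rw [Polynomial.natDegree_finsetProd_X_sub_C_eq_card]
  simp

theorem eval_gbinomPoly_neg (m k : ℕ) :
    0 ≤ (-1) ^ m * (gbinomPoly m).eval (-(k : ℝ)) := by
  have h : (-1) ^ m * ∏ i ∈ range m, (-(k : ℝ) - 1 - i) = ∏ i ∈ range m, ((k : ℝ) + 1 + i) := by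
    conv_lhs => rw [← Finset.card_range m, ← Finset.prod_const, Finset.card_range,
      ← Finset.prod_mul_distrib]
    exact Finset.prod_congr rfl fun i _ => by ring
  rw [eval_gbinomPoly, gbinom, ← mul_div_assoc, h]
  positivity

theorem gbinom_succ_mul (x : ℝ) (m : ℕ) :
    (m + 1) * gbinom x (m + 1) = x * gbinom (x - 1) m := by
  simp only [gbinom, Finset.prod_range_succ', Nat.factorial_succ]
  have : ∀ i : ℕ, x - 1 - i = x - ((i + 1 : ℕ) : ℝ) := fun i => by push_cast; ring
  simp only [this]
  have := m.factorial_ne_zero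
  push_cast
  field_simp
  ring

theorem gbinom_sub_gbinom (x : ℝ) (m : ℕ) :
    gbinom x (m + 1) - gbinom (x - 1) (m + 1) = gbinom (x - 1) m := by
  have h1 := gbinom_succ_mul x m
  have h2 : (m + 1) * gbinom (x - 1) (m + 1) = gbinom (x - 1) m * (x - 1 - m) := by
    simp only [gbinom, Finset.prod_range_succ, Nat.factorial_succ]
    have := m.factorial_ne_zero
    push_cast
    field_simp
  have hm : (m + 1 : ℝ) ≠ 0 := by positivity
  apply mul_left_cancel₀ hm
  linear_combination h1 - h2

end Gbinom

theorem fdiff_iterate_congr {f g : ℝ → ℝ} (h : ∀ x > (0 : ℝ), f x = g x) (n : ℕ) :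
    ∀ x > (0 : ℝ), fdiff^[n] f x = fdiff^[n] g x := by
  induction n generalizing f g with
  | zero => exact h
  | succ n ih =>
    simp only [Function.iterate_succ_apply]
    exact ih fun x hx => by simp only [fdiff, h x hx, h (x + 1) (by linarith)]

theorem fdiff_gbinom_mul_digamma (m : ℕ) {x : ℝ} (hx : 0 < x) :
    fdiff (fun y => gbinom (y - 1) (m + 1) * (digamma y - digamma ((m + 1 : ℕ) + 1))) x =
      gbinom (x - 1) m * (digamma x - digamma (m + 1)) := by
  have h1 := gbinom_sub_gbinom x m
  have h2 := gbinom_succ_mul x m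
  have hm : (0 : ℝ) < m + 1 := by positivity
  have h3 : gbinom x (m + 1) * (1 / x) = gbinom (x - 1) m * (1 / (m + 1)) := by
    field_simp
    linear_combination h2
  simp only [fdiff, add_sub_cancel_right, digamma_add_one hx, Nat.cast_succ, digamma_add_one hm]
  linear_combination (digamma x - digamma (m + 1) - 1 / (m + 1)) * h1 + h3

theorem fdiff_iterate_gbinom_mul_digamma (m : ℕ) :
    ∀ x > (0 : ℝ), fdiff^[m + 1]
      (fun y => gbinom (y - 1) m * (digamma y - digamma (m + 1))) x = 1 / x := by
  induction m with
  | zero =>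
    intro x hx
    simp [fdiff, gbinom, digamma_add_one hx]
  | succ m ih =>
    intro x hx
    rw [Function.iterate_succ_apply, ← ih x hx]
    exact fdiff_iterate_congr (fun y hy => fdiff_gbinom_mul_digamma m hy) _ x hx

theorem divDiff_gbinom_mul_digamma_nonneg {m q : ℕ} (hq : m ≤ q) (c : ℝ)
    {v : Fin (q + 2) → ℝ} (hpos : ∀ i, 0 < v i) (hv : Function.Injective v) :
    0 ≤ (-1) ^ (m + q) * divDiff (fun x => gbinom (x - 1) m * (digamma x - c)) v := by
  have hdeg := natDegree_gbinomPoly_le m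
  set P := gbinomPoly m with hP
  have hlim : Tendsto (fun N : ℕ => divDiff (fun x =>
      P.eval x * ((digamma N - ∑ k ∈ range N, 1 / (x + k)) - c)) v) atTop
      (nhds (divDiff (fun x => gbinom (x - 1) m * (digamma x - c)) v)) := by
    unfold divDiff
    refine tendsto_finsetSum _ fun i _ => ?_
    simp only [← eval_gbinomPoly, ← hP]
    exact (((tendsto_digamma_sub_sum (hpos i)).sub_const c).const_mul _).div_const _
  refine ge_of_tendsto' (hlim.const_mul _) fun N => ?_
  have hsplit : divDiff (fun x => P.eval x * ((digamma N - ∑ k ∈ range N, 1 / (x + k)) - c)) v =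
      (digamma N - c) * divDiff (fun x => P.eval x) v -
        ∑ k ∈ range N, divDiff (fun x => P.eval x / (x + k)) v := by
    unfold divDiff
    rw [Finset.sum_comm, Finset.mul_sum, ← Finset.sum_sub_distrib]
    refine Finset.sum_congr rfl fun i _ => ?_
    rw [← Finset.sum_div, Finset.sum_congr rfl fun k _ => div_eq_mul_one_div (P.eval (v i)) _,
      ← Finset.mul_sum]
    ring
  rw [hsplit, divDiff_eval_eq_zero P hv (by omega), mul_zero, zero_sub, ← Finset.sum_neg_distrib,
    Finset.mul_sum]
  refine Finset.sum_nonneg fun k _ => ?_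
  have hk : ∀ j, 0 < v j + k := fun j => add_pos_of_pos_of_nonneg (hpos j) k.cast_nonneg
  rw [divDiff_eval_div_add P hv (by omega) hk, neg_neg, ← mul_div_assoc]
  refine div_nonneg ?_ (Finset.prod_nonneg fun j _ => (hk j).le)
  have hsq : ((-1 : ℝ) ^ q) * (-1) ^ q = 1 := by rw [← mul_pow]; simp
  have hrw : (-1 : ℝ) ^ (m + q) * ((-1) ^ (q + 2) * P.eval (-(k : ℝ))) =
      (-1) ^ m * P.eval (-(k : ℝ)) := by
    rw [pow_add, pow_add]
    linear_combination ((-1) ^ m * P.eval (-(k : ℝ))) * hsq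
  rw [hrw]
  exact eval_gbinomPoly_neg m k

theorem evK_gbinom_mul_digamma (m q : ℕ) (c : ℝ) :
    EvK q (fun x => gbinom (x - 1) m * (digamma x - c)) := by
  have hlarge : ∀ r, m ≤ r → EvK r (fun x => gbinom (x - 1) m * (digamma x - c)) := by
    intro r hr
    rcases neg_one_pow_eq_or ℝ (m + r) with h | h
    · refine Or.inl ⟨1, one_pos, fun v hv hinj => ?_⟩
      have := divDiff_gbinom_mul_digamma_nonneg hr c
        (fun i => one_pos.trans (Set.mem_Ioi.1 (hv i))) hinj
      rwa [h, one_mul] at this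
    · refine Or.inr ⟨1, one_pos, fun v hv hinj => ?_⟩
      have := divDiff_gbinom_mul_digamma_nonneg hr c
        (fun i => one_pos.trans (Set.mem_Ioi.1 (hv i))) hinj
      rw [h, neg_one_mul] at this
      rwa [divDiff_neg]
  have hdown : ∀ d, EvK (q + d) (fun x => gbinom (x - 1) m * (digamma x - c)) →
      EvK q (fun x => gbinom (x - 1) m * (digamma x - c)) := by
    intro d
    induction d with
    | zero => exact id
    | succ d ih => exact fun h => ih h.of_succ
  exact hdown m (hlarge _ (Nat.le_add_left m q))

/-- `x ↦ C(x-1, m)(ψ(x) - ψ(m+1))` is the `(m+1)`-fold principal indefinite sum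
of the reciprocal function. -/
theorem stmt_17 (m : ℕ) (f : ℝ → ℝ)
    (hf : ∀ x : ℝ, f x = gbinom (x - 1) m * (digamma x - digamma (m + 1))) :
    (∀ x > (0 : ℝ), fdiff^[m + 1] f x = 1 / x) ∧
    (∀ j ∈ Finset.Icc 1 (m + 1), f j = 0) ∧
    DD (m + 1) f ∧
    (∀ q : ℕ, EvK q f) := by
  obtain rfl : f = fun x => gbinom (x - 1) m * (digamma x - digamma (m + 1)) := funext hf
  have hdiff := fdiff_iterate_gbinom_mul_digamma m
  refine ⟨hdiff, fun j hj => ?_, ?_, fun q => evK_gbinom_mul_digamma m q _⟩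
  · obtain ⟨h1, h2⟩ := Finset.mem_Icc.1 hj
    rcases h2.eq_or_lt with rfl | h
    · simp
    · have hzero : gbinom ((j : ℝ) - 1) m = 0 := by
        rw [gbinom, Finset.prod_eq_zero (Finset.mem_range.2 (by omega : j - 1 < m)), zero_div]
        rw [Nat.cast_sub h1]
        simp
      simp [hzero]
  · refine tendsto_one_div_atTop_nhds_zero_nat.congr' ?_
    filter_upwards [eventually_gt_atTop 0] with n hn
    exact (hdiff n (Nat.cast_pos.2 hn)).symm
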